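/- In the minimum-counterexample setup, for every acyclic edge coloring c of G−xy using Δ+1 colors, the color c(y,y') belongs to F''_x(c), i.e., c(y,y') equals the color of some edge from x to a neighbor of degree at least 3 in G. -/

import Mathlib

open SimpleGraph

namespace AEC

variable {V : Type*}

/-- The set of colors appearing (under partial coloring `c`) on colored edges incident
with the vertex `u` (i.e. `F_u`). -/
def colorsAt (G : SimpleGraph V) (c : Sym2 V → Option ℕ) (u : V) : Set ℕ :=
  {γ | ∃ z, G.Adj u z ∧ c s(u, z) = some γ}

/-- `S_ab`: the set of colors appearing on the colored edges incident with `b`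
other than the edge `ab`. -/
def Sset (G : SimpleGraph V) (c : Sym2 V → Option ℕ) (a b : V) : Set ℕ :=
  {γ | ∃ z, G.Adj b z ∧ z ≠ a ∧ c s(b, z) = some γ}

/-- A partial edge coloring (colors are `ℕ`, `none` = uncolored): it may only color
edges of `G`, and colored edges sharing an endpoint receive distinct colors. -/
def ProperPartialColoring (G : SimpleGraph V) (c : Sym2 V → Option ℕ) : Prop :=
  (∀ e, (c e).isSome → e ∈ G.edgeSet) ∧
  ∀ ⦃u v w : V⦄, G.Adj u v → G.Adj u w → v ≠ w → (c s(u, v)).isSome →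
    c s(u, v) ≠ c s(u, w)

/-- A valid (acyclic) partial coloring: proper, and no cycle of `G` is bichromatic,
i.e. no cycle has all of its edges colored using only two colors. -/
def AcyclicPartialColoring (G : SimpleGraph V) (c : Sym2 V → Option ℕ) : Prop :=
  ProperPartialColoring G c ∧
  ∀ (α β : ℕ) (v : V) (W : G.Walk v v), W.IsCycle →
    ¬ ∀ e ∈ W.edges, c e = some α ∨ c e = some β

/-- An acyclic edge coloring of `G` using (at most) `k` colors: a valid partial coloring
that colors every edge of `G` with a color `< k`. -/
def IsAcyclicEdgeColoring (G : SimpleGraph V) (k : ℕ) (c : Sym2 V → Option ℕ) : Prop :=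
  AcyclicPartialColoring G c ∧ ∀ e ∈ G.edgeSet, ∃ a, a < k ∧ c e = some a

/-- `G` is 2-degenerate: every nonempty (induced) subgraph has a vertex of degree at most 2. -/
def TwoDegenerate [DecidableEq V] (G : SimpleGraph V) [DecidableRel G.Adj] : Prop :=
  ∀ s : Finset V, s.Nonempty → ∃ v ∈ s, (s.filter fun u => G.Adj v u).card ≤ 2

/-- A maximal `(α,β)`-bichromatic path from `a` to `b`: a path all of whose edges are
colored `α` or `β`, which cannot be extended at either end. -/
def IsMaximalBichromaticPath (G : SimpleGraph V) (c : Sym2 V → Option ℕ)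
    (α β : ℕ) {a b : V} (W : G.Walk a b) : Prop :=
  W.IsPath ∧ (∀ e ∈ W.edges, c e = some α ∨ c e = some β) ∧
  (∀ w, G.Adj a w → (c s(a, w) = some α ∨ c s(a, w) = some β) → w ∈ W.support) ∧
  (∀ w, G.Adj b w → (c s(b, w) = some α ∨ c s(b, w) = some β) → w ∈ W.support)

/-- An `(α,β,a,b)`-maximal bichromatic path: a maximal `(α,β)`-bichromatic path from
`a` to `b` whose edge incident on `a` is colored `α`. -/
def IsMaxBichromaticPathFrom (G : SimpleGraph V) (c : Sym2 V → Option ℕ)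
    (α β : ℕ) {a b : V} (W : G.Walk a b) : Prop :=
  IsMaximalBichromaticPath G c α β W ∧ ∃ e, W.edges.head? = some e ∧ c e = some α

/-- An `(α,β,ab)`-critical path: a maximal `(α,β)`-bichromatic path from `a` to `b` whose
edges incident on `a` and on `b` are both colored `α`. -/
def IsCriticalPath (G : SimpleGraph V) (c : Sym2 V → Option ℕ)
    (α β : ℕ) {a b : V} (W : G.Walk a b) : Prop :=
  IsMaxBichromaticPathFrom G c α β W ∧ ∃ e, W.edges.getLast? = some e ∧ c e = some α

/-- `F''_x(c)`: colors of edges from `x` to its neighbors (other than `y`) of degree ≥ 3. -/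
def Fpp [Fintype V] (G : SimpleGraph V) [DecidableRel G.Adj]
    (c : Sym2 V → Option ℕ) (x y : V) : Set ℕ :=
  {γ | ∃ z, G.Adj x z ∧ z ≠ y ∧ 3 ≤ G.degree z ∧ c s(x, z) = some γ}

/-- `F'_x(c)`: colors of edges from `x` to its neighbors (other than `y`) of degree 2. -/
def Fp [Fintype V] (G : SimpleGraph V) [DecidableRel G.Adj]
    (c : Sym2 V → Option ℕ) (x y : V) : Set ℕ :=
  {γ | ∃ z, G.Adj x z ∧ z ≠ y ∧ G.degree z = 2 ∧ c s(x, z) = some γ}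

/-- `F_x(c) = F'_x(c) ∪ F''_x(c)`. -/
def Fx [Fintype V] (G : SimpleGraph V) [DecidableRel G.Adj]
    (c : Sym2 V → Option ℕ) (x y : V) : Set ℕ :=
  Fp G c x y ∪ Fpp G c x y

/-- In a cycle, every edge `uv` is followed at `u` by a second edge. -/
theorem exists_ne_mem_edges_of_isCycle {G : SimpleGraph V} {a u v : V} {W : G.Walk a a}
    (hW : W.IsCycle) (h : s(u, v) ∈ W.edges) : ∃ w, w ≠ v ∧ s(u, w) ∈ W.edges := by
  have hcard := hW.ncard_neighborSet_toSubgraph_eq_two (W.fst_mem_support_of_mem_edges h)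
  obtain ⟨w, hw, hwv⟩ := Set.exists_ne_of_one_lt_ncard (hcard ▸ Nat.one_lt_two) v
  exact ⟨w, hwv, by simpa [Walk.adj_toSubgraph_iff_mem_edges] using hw⟩

/-- Coloring the missing edge `xy` with a color `β` absent at both of its ends extends an acyclic
edge coloring, provided that `yy'` is the only other edge at `y` and that no neighbor of `x` along
an edge with the color of `yy'` has an edge of color `β`. -/
theorem isAcyclicEdgeColoring_update [DecidableEq V] {G : SimpleGraph V} {k : ℕ}
    {c : Sym2 V → Option ℕ} {x y y' : V} {α β : ℕ} (hxy : G.Adj x y)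
    (hy : ∀ w, G.Adj y w → w = x ∨ w = y')
    (hc : IsAcyclicEdgeColoring (G.deleteEdges {s(x, y)}) k c)
    (hα : c s(y, y') = some α) (hβ : β < k) (hβα : β ≠ α)
    (hβx : ∀ z, G.Adj x z → z ≠ y → c s(x, z) ≠ some β)
    (hβz : ∀ z, G.Adj x z → z ≠ y → c s(x, z) = some α →
      ∀ t, G.Adj z t → t ≠ x → c s(z, t) ≠ some β) :
    IsAcyclicEdgeColoring G k (Function.update c s(x, y) (some β)) := by
  obtain ⟨⟨⟨hsupp, hprop⟩, hacyc⟩, htot⟩ := hc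
  have hβy : ∀ w, G.Adj y w → w ≠ x → c s(y, w) ≠ some β := by
    intro w hw hwx
    obtain rfl | rfl := hy w hw
    · exact absurd rfl hwx
    · rw [hα]
      simpa using hβα.symm
  have hβu : ∀ u v w, s(u, v) = s(x, y) → G.Adj u w → w ≠ v → c s(u, w) ≠ some β := by
    intro u v w huv hw hwv
    rcases Sym2.eq_iff.1 huv with ⟨rfl, rfl⟩ | ⟨rfl, rfl⟩
    · exact hβx w hw hwv
    · exact hβy w hw hwv
  have hold : ∀ e, e ≠ s(x, y) → Function.update c s(x, y) (some β) e = c e :=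
    fun e he => Function.update_of_ne he _ _
  have hadj : ∀ u v, G.Adj u v → s(u, v) ≠ s(x, y) →
      (G.deleteEdges {s(x, y)}).Adj u v := fun u v h h' => by
    rw [deleteEdges_adj]
    exact ⟨h, h'⟩
  refine ⟨⟨⟨?_, ?_⟩, ?_⟩, ?_⟩
  · intro e he
    by_cases h : e = s(x, y)
    · exact h ▸ hxy
    · rw [hold e h] at he
      exact edgeSet_mono (deleteEdges_le _) (hsupp e he)
  · intro u v w huv huw hvw hs
    by_cases h1 : s(u, v) = s(x, y)
    · have h2 : s(u, w) ≠ s(x, y) := fun h2 => hvw (Sym2.congr_right.1 (h1.trans h2.symm))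
      rw [hold _ h2, h1, Function.update_self]
      exact (hβu u v w h1 huw hvw.symm).symm
    · rw [hold _ h1] at hs ⊢
      by_cases h2 : s(u, w) = s(x, y)
      · rw [h2, Function.update_self]
        exact hβu u w v h2 huv hvw
      · rw [hold _ h2]
        exact hprop (hadj _ _ huv h1) (hadj _ _ huw h2) hvw hs
  · intro γ δ v W hW hall
    by_cases hmem : s(x, y) ∈ W.edges
    · obtain ⟨w, hwx, hw⟩ := exists_ne_mem_edges_of_isCycle hW
        (show s(y, x) ∈ W.edges by rwa [Sym2.eq_swap])
      obtain ⟨z, hzy, hz⟩ := exists_ne_mem_edges_of_isCycle hW hmem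
      obtain ⟨t, htx, ht⟩ := exists_ne_mem_edges_of_isCycle hW
        (show s(z, x) ∈ W.edges by rwa [Sym2.eq_swap])
      have hyw := W.adj_of_mem_edges hw
      have hxz := W.adj_of_mem_edges hz
      have hzt := W.adj_of_mem_edges ht
      obtain rfl : w = y' := (hy w hyw).resolve_left hwx
      have e1 : s(y, w) ≠ s(x, y) := by
        rw [Sym2.eq_swap (a := x)]
        exact fun h => hwx (Sym2.congr_right.1 h)
      have e2 : s(x, z) ≠ s(x, y) := fun h => hzy (Sym2.congr_right.1 h)
      have e3 : s(z, t) ≠ s(x, y) := fun h => by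
        rcases Sym2.eq_iff.1 h with ⟨h, -⟩ | ⟨-, h⟩
        · exact hxz.ne h.symm
        · exact htx h
      have b0 := hall _ hmem
      have b1 := hall _ hw
      have b2 := hall _ hz
      have b3 := hall _ ht
      rw [Function.update_self] at b0
      rw [hold _ e1, hα] at b1
      rw [hold _ e2] at b2
      rw [hold _ e3] at b3
      have hxz' := hβx z hxz hzy
      have hzα : c s(x, z) = some α := by grind
      have hzt' := hβz z hxz hzy hzα t hzt htx
      have := hprop (hadj _ _ hxz.symm (by rwa [Sym2.eq_swap])) (hadj _ _ hzt e3) htx.symm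
        (by rw [Sym2.eq_swap, hzα]; rfl)
      rw [Sym2.eq_swap, hzα] at this
      grind
    · have hW' : ∀ e ∈ W.edges, e ∈ (G.deleteEdges {s(x, y)}).edgeSet := fun e he => by
        rw [edgeSet_deleteEdges]
        exact ⟨W.edges_subset_edgeSet he, fun h => hmem (h ▸ he)⟩
      refine hacyc γ δ v (W.transfer _ hW') (hW.transfer hW') fun e he => ?_
      rw [Walk.edges_transfer] at he
      rw [← hold e fun h => hmem (h ▸ he)]
      exact hall e he
  · intro e he
    by_cases h : e = s(x, y)
    · exact ⟨β, hβ, by rw [h, Function.update_self]⟩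
    · rw [hold e h]
      exact htot e (by rw [edgeSet_deleteEdges]; exact ⟨he, h⟩)

/-- Lemma 2: in the minimum-counterexample setup, for every acyclic edge
coloring `c` of `G − xy` with `Δ+1` colors, the color `c(y,y')` belongs to `F''_x(c)`. -/
theorem color_yy'_mem_Fpp
    {V : Type*} [Fintype V] [DecidableEq V] (G : SimpleGraph V) [DecidableRel G.Adj]
    (h2deg : TwoDegenerate G)
    (hmin : ¬ ∃ c : Sym2 V → Option ℕ, IsAcyclicEdgeColoring G (G.maxDegree + 1) c)
    (hdel : ∀ e ∈ G.edgeSet, ∃ c : Sym2 V → Option ℕ,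
      IsAcyclicEdgeColoring (G.deleteEdges {e}) (G.maxDegree + 1) c)
    (x : V)
    (hxdeg2 : ∃ z, G.Adj x z ∧ G.degree z = 2)
    (hxdeg3 : ((G.neighborFinset x).filter fun z => 3 ≤ G.degree z).card ≤ 2)
    (y y' : V) (hxy : G.Adj x y) (hy2 : G.degree y = 2)
    (hyy' : G.Adj y y') (hy'x : y' ≠ x)
    (c : Sym2 V → Option ℕ)
    (hc : IsAcyclicEdgeColoring (G.deleteEdges {s(x, y)}) (G.maxDegree + 1) c) :
    ∃ z, G.Adj x z ∧ z ≠ y ∧ 3 ≤ G.degree z ∧ c s(x, z) = c s(y, y') := by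
  by_contra! hcon
  have hxyα : s(y, y') ≠ s(x, y) := by
    rw [Sym2.eq_swap (a := x)]
    exact fun h => hy'x (Sym2.congr_right.1 h)
  obtain ⟨α, -, hα⟩ := hc.2 s(y, y') (by
    rw [edgeSet_deleteEdges]
    exact ⟨hyy', hxyα⟩)
  have hy : ∀ w, G.Adj y w → w = x ∨ w = y' := by
    have hsub : ({x, y'} : Finset V) ⊆ G.neighborFinset y := by
      simp [Finset.insert_subset_iff, hxy.symm, hyy']
    have heq := Finset.eq_of_subset_of_card_le hsub (by
      rw [card_neighborFinset_eq_degree, hy2, Finset.card_pair hy'x.symm])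
    intro w hw
    have : w ∈ G.neighborFinset y := by simpa using hw
    simpa [← heq] using this
  let S := ((G.neighborFinset x).erase y).image fun z => (c s(x, z)).getD 0
  have hS : S.card + 1 ≤ G.maxDegree := by
    have h1 : S.card ≤ ((G.neighborFinset x).erase y).card := Finset.card_image_le
    have h2 := Finset.card_erase_add_one (s := G.neighborFinset x) (a := y) (by simpa using hxy)
    rw [card_neighborFinset_eq_degree] at h2
    have := G.degree_le_maxDegree x
    omega
  have hmemS : ∀ z γ, G.Adj x z → z ≠ y → c s(x, z) = some γ → γ ∈ S := by
    intro z γ hz hzy h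
    exact Finset.mem_image.2 ⟨z, by simp [hz, hzy], by simp [h]⟩
  obtain ⟨T, hT, hαT, hzT⟩ : ∃ T : Finset ℕ, T.card ≤ 1 ∧ α ∈ S ∪ T ∧
      ∀ z, G.Adj x z → z ≠ y → c s(x, z) = some α →
        ∀ t γ, G.Adj z t → t ≠ x → c s(z, t) = some γ → γ ∈ T := by
    by_cases hex : ∃ z, G.Adj x z ∧ z ≠ y ∧ c s(x, z) = some α
    · obtain ⟨z, hz, hzy, hzα⟩ := hex
      refine ⟨((G.neighborFinset z).erase x).image fun t => (c s(z, t)).getD 0, ?_,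
        Finset.mem_union_left _ (hmemS z α hz hzy hzα), ?_⟩
      · have h2 := Finset.card_erase_add_one (s := G.neighborFinset z) (a := x)
          (by simpa using hz.symm)
        rw [card_neighborFinset_eq_degree] at h2
        have h3 : ¬ 3 ≤ G.degree z := fun h3 => hcon z hz hzy h3 (hzα.trans hα.symm)
        exact Finset.card_image_le.trans (by omega)
      · intro w hw hwy hwα t γ ht htx hγ
        have hwz : w = z := by
          by_contra hne
          refine hc.1.1.2 (u := x) (v := w) (w := z) ?_ ?_ hne (by simp [hwα])
            (hwα.trans hzα.symm)
          · rw [deleteEdges_adj]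
            exact ⟨hw, fun h => hwy (Sym2.congr_right.1 h)⟩
          · rw [deleteEdges_adj]
            exact ⟨hz, fun h => hzy (Sym2.congr_right.1 h)⟩
        subst hwz
        exact Finset.mem_image.2 ⟨t, by simp [ht, htx], by simp [hγ]⟩
    · exact ⟨{α}, by simp, by simp, fun z hz hzy hzα => absurd ⟨z, hz, hzy, hzα⟩ hex⟩
  obtain ⟨β, hβ, hβST⟩ := Finset.exists_mem_notMem_of_card_lt_card
    (s := S ∪ T) (t := Finset.range (G.maxDegree + 1)) (by
      have := Finset.card_union_le S T
      rw [Finset.card_range]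
      omega)
  exact hmin ⟨_, isAcyclicEdgeColoring_update hxy hy hc hα (Finset.mem_range.1 hβ)
    (fun h => hβST (h ▸ hαT))
    (fun z hz hzy h => hβST (Finset.mem_union_left _ (hmemS z β hz hzy h)))
    (fun z hz hzy hzα t ht htx h =>
      hβST (Finset.mem_union_right _ (hzT z hz hzy hzα t β ht htx h)))⟩

end AEC
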